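/- arXiv:2109.04000 — 3 statements merged into one kernel-verified Lean document; each statement's English description precedes it below -/
import Mathlib

section
/- Let G be a finite graph whose smallest adjacency eigenvalue is at least −3 (equivalently, A(G) + 3I is positive semidefinite). Let C be a clique of G of order c with 29 ≤ c ≤ 32, and let x be a vertex of G not in C having exactly t neighbours in C. Then: if c = 29 then t ≤ 8 or t ≥ 23; if c = 30 then t ≤ 8 or t ≥ 24; if c = 31 then t ≤ 7 or t ≥ 26; if c = 32 then t ≤ 7 or t ≥ 27. -/
/-- If `A(G) + 3I` is positive semidefinite, then a vertex `x` outside a clique `C` with exactly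
`t` neighbours in `C` satisfies `t (|C| + 2 - t) ≤ 6 (|C| + 2)`. -/
theorem card_neighbors_in_clique_bound {V : Type*} [Fintype V] [DecidableEq V]
    (G : SimpleGraph V) [DecidableRel G.Adj]
    (hpsd : (G.adjMatrix ℝ + (3 : ℝ) • (1 : Matrix V V ℝ)).PosSemidef)
    (C : Finset V) (hC : G.IsClique (C : Set V)) (x : V) (hx : x ∉ C) (t : ℕ)
    (ht : (C.filter fun w => G.Adj x w).card = t) :
    (t : ℝ) * (C.card + 2 - t) ≤ 6 * (C.card + 2) := by
  set m : ℝ := (C.card : ℝ) + 2 with hm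
  have hm_pos : 0 < m := by positivity
  set M : Matrix V V ℝ := G.adjMatrix ℝ + (3 : ℝ) • (1 : Matrix V V ℝ) with hM
  let y : V → ℝ := fun w => (t : ℝ) - if G.Adj x w then m else 0
  let v : V → ℝ := fun w => (if w = x then 2 * m else 0) + if w ∈ C then y w else 0
  have hMv (w : V) : (M.mulVec v) w = M w x * (2 * m) + ∑ u ∈ C, M w u * y u := by
    simp [Matrix.mulVec, dotProduct, v, mul_add, Finset.sum_add_distrib, Finset.sum_ite_mem]
  have hind : ∑ u ∈ C, (if G.Adj x u then (1 : ℝ) else 0) = t := by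
    rw [Finset.sum_boole, ht]
  have hy : ∑ u ∈ C, y u = t * (C.card - m) := by
    have : ∀ u, y u = t - m * (if G.Adj x u then (1 : ℝ) else 0) := by
      intro u
      simp only [y, mul_ite, mul_one, mul_zero]
    simp only [this, Finset.sum_sub_distrib, ← Finset.mul_sum, hind, Finset.sum_const,
      nsmul_eq_mul]
    ring
  have hMx : (M.mulVec v) x = 6 * m - t * (m - t) := by
    rw [hMv]
    have h : ∀ u ∈ C, M x u * y u = (t - m) * (if G.Adj x u then (1 : ℝ) else 0) := by
      intro u hu
      have hne : x ≠ u := fun h => hx (h ▸ hu)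
      by_cases h : G.Adj x u <;> simp [hM, y, h, hne]
    rw [Finset.sum_congr rfl h, ← Finset.mul_sum, hind]
    simp only [hM, Matrix.add_apply, SimpleGraph.adjMatrix_apply, SimpleGraph.irrefl,
      Matrix.smul_apply, Matrix.one_apply_eq, if_false, smul_eq_mul]
    ring
  have hMC : ∀ w ∈ C, (M.mulVec v) w = 0 := by
    intro w hw
    rw [hMv]
    have h : ∀ u ∈ C, M w u * y u = y u + if w = u then 2 * y u else 0 := by
      intro u hu
      by_cases h : w = u
      · subst h
        simp [hM]
        ring
      · simp [hM, h, hC hw hu h]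
    rw [Finset.sum_congr rfl h, Finset.sum_add_distrib, hy, Finset.sum_ite_eq, if_pos hw]
    have hne : w ≠ x := fun h => hx (h ▸ hw)
    by_cases h : G.Adj x w
    · simp only [hM, y, Matrix.add_apply, SimpleGraph.adjMatrix_apply, h, h.symm,
        Matrix.smul_apply, Matrix.one_apply_ne hne, if_true, smul_eq_mul]
      rw [hm]
      ring
    · simp only [hM, y, Matrix.add_apply, SimpleGraph.adjMatrix_apply, h, G.adj_comm w x,
        Matrix.smul_apply, Matrix.one_apply_ne hne, if_false, smul_eq_mul]
      rw [hm]
      ring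
  have hform : v ⬝ᵥ M.mulVec v = 2 * m * (M.mulVec v) x := by
    have hzero : ∑ w ∈ C, y w * (M.mulVec v) w = 0 :=
      Finset.sum_eq_zero fun w hw => by rw [hMC w hw, mul_zero]
    have : ∀ z : V → ℝ, v ⬝ᵥ z = 2 * m * z x + ∑ w ∈ C, y w * z w := by
      intro z
      simp [dotProduct, v, add_mul, Finset.sum_add_distrib, Finset.sum_ite_mem]
    rw [this, hzero, add_zero]
  have hnonneg : 0 ≤ v ⬝ᵥ M.mulVec v := by
    simpa using hpsd.dotProduct_mulVec_nonneg v
  rw [hform, hMx] at hnonneg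
  have := nonneg_of_mul_nonneg_right hnonneg (by positivity)
  linarith

/-- Let `G` be a finite graph whose smallest adjacency eigenvalue is at least `-3`
(equivalently, `A(G) + 3I` is positive semidefinite). If `C` is a clique of order `c` with
`29 ≤ c ≤ 32` and `x ∉ C` has exactly `t` neighbours in `C`, then `t` is at most `t_min` or
at least `t_max`, where `(t_min, t_max)` is `(8,23), (8,24), (7,26), (7,27)` for
`c = 29, 30, 31, 32` respectively. -/
theorem clique_neighbour_gap {V : Type*} [Fintype V] [DecidableEq V] (G : SimpleGraph V)
    [DecidableRel G.Adj]
    (hpsd : (G.adjMatrix ℝ + (3 : ℝ) • (1 : Matrix V V ℝ)).PosSemidef)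
    (C : Finset V) (c : ℕ) (hC : G.IsNClique c C) (hc29 : 29 ≤ c) (hc32 : c ≤ 32)
    (x : V) (hx : x ∉ C) (t : ℕ) (ht : (C.filter fun w => G.Adj x w).card = t) :
    (c = 29 → t ≤ 8 ∨ 23 ≤ t) ∧
    (c = 30 → t ≤ 8 ∨ 24 ≤ t) ∧
    (c = 31 → t ≤ 7 ∨ 26 ≤ t) ∧
    (c = 32 → t ≤ 7 ∨ 27 ≤ t) := by
  have key := card_neighbors_in_clique_bound G hpsd C hC.isClique x hx t ht
  rw [hC.card_eq] at key
  refine ⟨?_, ?_, ?_, ?_⟩ <;>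
  · rintro rfl
    by_contra! h
    obtain ⟨h1, h2⟩ := h
    push_cast at key
    interval_cases t <;> norm_num at key
end

section
/- Let G be a strongly regular graph with parameters (1911, 270, 105, 27) containing an induced quadrangle x ~ u ~ y ~ v ~ x, and let W = {w : w ~ x, w ∉ {u, v}, w not adjacent to u, w not adjacent to v}. If z ∈ W has at least one non-neighbour in W \ {z}, then the set K_z = {w ∈ W : w ≠ z, w not adjacent to z} is a clique of G of order at least 28, and K_z ∪ {x} is also a clique of G. -/
namespace SimpleGraph

variable {V : Type*} [Fintype V] [DecidableEq V] {G : SimpleGraph V} [DecidableRel G.Adj]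

/-- The neighbours of `x` that are equal or adjacent to `w`. -/
def localClosedNbhd (G : SimpleGraph V) [DecidableRel G.Adj] (x w : V) : Finset V :=
  insert w (G.neighborFinset x ∩ G.neighborFinset w)

theorem mem_localClosedNbhd {x w a : V} (hxw : G.Adj x w) :
    a ∈ G.localClosedNbhd x w ↔ G.Adj x a ∧ (a = w ∨ G.Adj w a) := by
  simp only [localClosedNbhd, Finset.mem_insert, Finset.mem_inter, mem_neighborFinset]
  grind

theorem localClosedNbhd_subset {x w : V} (hxw : G.Adj x w) :
    G.localClosedNbhd x w ⊆ G.neighborFinset x := fun a ha => by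
  rw [mem_neighborFinset]
  exact ((mem_localClosedNbhd hxw).1 ha).1

theorem IsSRGWith.card_commonNeighbors_finset {n k l m : ℕ} (h : G.IsSRGWith n k l m) {a b : V}
    (hne : a ≠ b) (hab : ¬ G.Adj a b) :
    (G.neighborFinset a ∩ G.neighborFinset b).card = m := by
  rw [← h.of_not_adj hne hab, ← Set.toFinset_card]
  congr 1
  ext c
  simp [mem_commonNeighbors]

theorem IsSRGWith.card_localClosedNbhd {n k l m : ℕ} (h : G.IsSRGWith n k l m) {x w : V}
    (hxw : G.Adj x w) : (G.localClosedNbhd x w).card = l + 1 := by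
  rw [localClosedNbhd, Finset.card_insert_of_notMem (by simp), ← h.of_adj x w hxw,
    ← Set.toFinset_card]
  congr 2
  ext c
  simp [mem_commonNeighbors]

/-- If `S` is a set of common neighbours of the non-adjacent vertices `a` and `b`, disjoint from
the neighbourhood of `x`, then the local closed neighbourhoods of `a` and `b` at `x` meet in at
most `m - |S|` vertices. -/
theorem IsSRGWith.card_localClosedNbhd_inter_add_card_le {n k l m : ℕ} (h : G.IsSRGWith n k l m)
    {x a b : V} (hxa : G.Adj x a) (hxb : G.Adj x b) (hne : a ≠ b) (hab : ¬ G.Adj a b)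
    {S : Finset V} (hS : S ⊆ G.neighborFinset a ∩ G.neighborFinset b)
    (hSx : ∀ s ∈ S, ¬ G.Adj x s) :
    (G.localClosedNbhd x a ∩ G.localClosedNbhd x b).card + S.card ≤ m := by
  rw [← h.card_commonNeighbors_finset hne hab, ← Finset.card_union_of_disjoint]
  · refine Finset.card_le_card (Finset.union_subset (fun c hc => ?_) hS)
    rw [Finset.mem_inter, mem_localClosedNbhd hxa, mem_localClosedNbhd hxb] at hc
    rw [Finset.mem_inter, mem_neighborFinset, mem_neighborFinset]
    grind [G.adj_comm]
  · rw [Finset.disjoint_left]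
    intro c hc hcS
    rw [Finset.mem_inter, mem_localClosedNbhd hxa] at hc
    exact hSx c hcS hc.1.1

theorem IsSRGWith.card_localClosedNbhd_inter_lt {n k l m : ℕ} (h : G.IsSRGWith n k l m)
    {x a b : V} (hxa : G.Adj x a) (hxb : G.Adj x b) (hne : a ≠ b) (hab : ¬ G.Adj a b) :
    (G.localClosedNbhd x a ∩ G.localClosedNbhd x b).card < m := by
  have := h.card_localClosedNbhd_inter_add_card_le hxa hxb hne hab (S := {x})
    (by simp [hxa.symm, hxb.symm]) (by simp)
  simpa using this

end SimpleGraph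

theorem Finset.card_add_card_le_card_union_add {α : Type*} [DecidableEq α] (s t : Finset α) :
    s.card + t.card ≤ (s ∪ t).card + (s ∩ t).card :=
  (Finset.card_union_add_card_inter s t).ge

theorem Finset.card_union_inter_le {α : Type*} [DecidableEq α] (s t r : Finset α) :
    ((s ∪ t) ∩ r).card ≤ (s ∩ r).card + (t ∩ r).card := by
  rw [Finset.union_inter_distrib_right]
  exact Finset.card_union_le _ _

/-- Let `G` be a strongly regular graph with parameters `(1911, 270, 105, 27)` with an induced
quadrangle `x ~ u ~ y ~ v ~ x`, and let
`W = {w : w ~ x, w ∉ {u,v}, w ≁ u, w ≁ v}`. If `z ∈ W` has at least one non-neighbour in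
`W \ {z}`, then `K_z = {w ∈ W : w ≠ z, w ≁ z}` is a clique of order at least `28`, and
`K_z ∪ {x}` is also a clique. -/
theorem srg_1911_Kz_clique {V : Type*} [Fintype V] [DecidableEq V]
    (G : SimpleGraph V) [DecidableRel G.Adj] (h : G.IsSRGWith 1911 270 105 27)
    (x u y v : V)
    (hd : x ≠ u ∧ x ≠ y ∧ x ≠ v ∧ u ≠ y ∧ u ≠ v ∧ y ≠ v)
    (hxu : G.Adj x u) (huy : G.Adj u y) (hyv : G.Adj y v) (hvx : G.Adj v x)
    (hxy : ¬ G.Adj x y) (huv : ¬ G.Adj u v)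
    (W : Finset V)
    (hW : W = Finset.univ.filter fun w =>
      G.Adj x w ∧ w ≠ u ∧ w ≠ v ∧ ¬ G.Adj u w ∧ ¬ G.Adj v w)
    (z : V) (hz : z ∈ W) (hz' : ∃ z' ∈ W, z' ≠ z ∧ ¬ G.Adj z z')
    (Kz : Finset V) (hKz : Kz = W.filter fun w => w ≠ z ∧ ¬ G.Adj w z) :
    G.IsClique (Kz : Set V) ∧ 28 ≤ Kz.card ∧ G.IsClique ((insert x Kz : Finset V) : Set V) := by
  obtain ⟨-, hxyne, -, -, huvne, -⟩ := hd
  have hW' (w : V) : w ∈ W ↔ G.Adj x w ∧ w ≠ u ∧ w ≠ v ∧ ¬ G.Adj u w ∧ ¬ G.Adj v w := by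
    simp [hW]
  have hK (w : V) : w ∈ Kz ↔ w ∈ W ∧ w ≠ z ∧ ¬ G.Adj w z := by simp [hKz]
  obtain ⟨hxz, hzu, hzv, huz, hvz⟩ := (hW' z).1 hz
  have hxv := hvx.symm
  set A := G.localClosedNbhd x
  have hA {w : V} (hw : G.Adj x w) : (A w).card = 106 := h.card_localClosedNbhd hw
  have hI {a b : V} (ha : G.Adj x a) (hb : G.Adj x b) (hne : a ≠ b) (hab : ¬ G.Adj a b) :
      (A a ∩ A b).card < 27 := h.card_localClosedNbhd_inter_lt ha hb hne hab
  have hIuv : (A u ∩ A v).card + ({x, y} : Finset V).card ≤ 27 :=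
    h.card_localClosedNbhd_inter_add_card_le hxu hxv huvne huv
      (by simp [Finset.insert_subset_iff, hxu.symm, hvx, huy, hyv.symm]) (by simp [hxy])
  rw [Finset.card_pair hxyne] at hIuv
  have hclique : G.IsClique (Kz : Set V) := by
    intro p hp q hq hpq
    by_contra hpq'
    rw [Finset.mem_coe, hK, hW'] at hp hq
    obtain ⟨⟨hxp, hpu, hpv, hup, hvp⟩, hpz, hzp⟩ := hp
    obtain ⟨⟨hxq, hqu, hqv, huq, hvq⟩, hqz, hzq⟩ := hq
    rw [G.adj_comm] at hzp hzq
    have huz' := hI hxu hxz hzu.symm huz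
    have hvz' := hI hxv hxz hzv.symm hvz
    have hup' := hI hxu hxp hpu.symm hup
    have hvp' := hI hxv hxp hpv.symm hvp
    have hzp' := hI hxz hxp hpz.symm hzp
    have huq' := hI hxu hxq hqu.symm huq
    have hvq' := hI hxv hxq hqv.symm hvq
    have hzq' := hI hxz hxq hqz.symm hzq
    have hpq'' := hI hxp hxq hpq hpq'
    have hcover : (A u ∪ A v ∪ A z ∪ A p ∪ A q).card ≤ 270 := by
      rw [← h.regular.degree_eq x, ← G.card_neighborFinset_eq_degree]
      refine Finset.card_le_card ?_
      simp only [Finset.union_subset_iff]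
      exact ⟨⟨⟨⟨SimpleGraph.localClosedNbhd_subset hxu, SimpleGraph.localClosedNbhd_subset hxv⟩,
        SimpleGraph.localClosedNbhd_subset hxz⟩, SimpleGraph.localClosedNbhd_subset hxp⟩, SimpleGraph.localClosedNbhd_subset hxq⟩
    have cu := hA hxu
    have cv := hA hxv
    have cz := hA hxz
    have cp := hA hxp
    have cq := hA hxq
    have uv := (A u).card_add_card_le_card_union_add (A v)
    have uvz := (A u ∪ A v).card_add_card_le_card_union_add (A z)
    have uvzp := (A u ∪ A v ∪ A z).card_add_card_le_card_union_add (A p)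
    have uvzpq := (A u ∪ A v ∪ A z ∪ A p).card_add_card_le_card_union_add (A q)
    have iz := (A u).card_union_inter_le (A v) (A z)
    have ip := (A u).card_union_inter_le (A v) (A p)
    have ip' := (A u ∪ A v).card_union_inter_le (A z) (A p)
    have iq := (A u).card_union_inter_le (A v) (A q)
    have iq' := (A u ∪ A v).card_union_inter_le (A z) (A q)
    have iq'' := (A u ∪ A v ∪ A z).card_union_inter_le (A p) (A q)
    omega
  refine ⟨hclique, ?_, ?_⟩
  · obtain ⟨p, hp, hpz, hzp⟩ := hz'
    obtain ⟨hxp, hpu, hpv, hup, hvp⟩ := (hW' p).1 hp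
    have hup' := hI hxu hxp hpu.symm hup
    have hvp' := hI hxv hxp hpv.symm hvp
    have hzp' := hI hxz hxp hpz.symm hzp
    have hsub : A p \ (A u ∪ A v ∪ A z) ⊆ Kz := fun a ha => by
      simp only [Finset.mem_sdiff, Finset.mem_union, A, SimpleGraph.mem_localClosedNbhd, hxp, hxu, hxv,
        hxz] at ha
      rw [hK, hW', G.adj_comm a z]
      tauto
    have hcard := Finset.card_le_card hsub
    rw [Finset.card_sdiff] at hcard
    have ip := (A u).card_union_inter_le (A v) (A p)
    have ip' := (A u ∪ A v).card_union_inter_le (A z) (A p)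
    have cp := hA hxp
    omega
  · rw [Finset.coe_insert]
    refine hclique.insert fun w hw _ => ?_
    rw [Finset.mem_coe, hK, hW'] at hw
    exact hw.1.1
end

section
/- Let G be a strongly regular graph with parameters (1911, 270, 105, 27) containing an induced quadrangle x ~ u ~ y ~ v ~ x, let W = {w : w ~ x, w ∉ {u, v}, w not adjacent to u, w not adjacent to v}, and for w ∈ W let k_w be the number of neighbours of w inside W. Then for every w ∈ W, k_w ∈ {53, 54, |W| − 1}. Moreover, if |W| = 82, then k_w ∈ {53, |W| − 1} for every w ∈ W, and any two distinct non-adjacent vertices z, z' ∈ W satisfy |N(x) ∩ N(z) ∩ N(z')| = 26. -/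
namespace SimpleGraph

open Finset

variable {V : Type*} {G : SimpleGraph V} [DecidableRel G.Adj]

lemma IsSRGWith.card_filter_adj [Fintype V] {n k l m : ℕ}
    (h : G.IsSRGWith n k l m) {x u : V} (hxu : G.Adj x u) :
    ((G.neighborFinset x).filter fun t => G.Adj u t).card = l := by
  rw [← h.of_adj x u hxu, ← Set.toFinset_card]
  congr 1
  ext t
  simp [mem_commonNeighbors]

lemma IsSRGWith.card_common_add_card_le [Fintype V] [DecidableEq V] {n k l m : ℕ}
    (h : G.IsSRGWith n k l m) (x : V) {a b : V}
    (hab : a ≠ b) (hnab : ¬ G.Adj a b) (T : Finset V)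
    (hT : ∀ t ∈ T, G.Adj a t ∧ G.Adj b t ∧ ¬ G.Adj x t) :
    ((G.neighborFinset x).filter fun t => G.Adj a t ∧ G.Adj b t).card + T.card ≤ m := by
  rw [← h.of_not_adj hab hnab, ← Set.toFinset_card, ← card_union_of_disjoint]
  · refine card_le_card fun t ht => ?_
    simp only [mem_union, mem_filter, Set.mem_toFinset, mem_commonNeighbors] at ht ⊢
    rcases ht with ht | ht
    · exact ht.2
    · exact ⟨(hT t ht).1, (hT t ht).2.1⟩
  · rw [Finset.disjoint_left]
    intro t ht htT
    simp only [mem_filter, mem_neighborFinset] at ht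
    exact (hT t htT).2.2 ht.1

/-- Inclusion–exclusion bound for a coclique of size four in a finite set `S`. -/
lemma card_coclique_four_le [DecidableEq V] (S : Finset V) {a b c d : V}
    (ha : a ∈ S) (hb : b ∈ S) (hc : c ∈ S) (hd : d ∈ S)
    (hab : a ≠ b) (hac : a ≠ c) (had : a ≠ d) (hbc : b ≠ c) (hbd : b ≠ d) (hcd : c ≠ d)
    (nab : ¬ G.Adj a b) (nac : ¬ G.Adj a c) (nad : ¬ G.Adj a d)
    (nbc : ¬ G.Adj b c) (nbd : ¬ G.Adj b d) (ncd : ¬ G.Adj c d) :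
    4 + (S.filter fun t => G.Adj a t).card + (S.filter fun t => G.Adj b t).card
      + (S.filter fun t => G.Adj c t).card + (S.filter fun t => G.Adj d t).card
      + (S.filter fun t => G.Adj a t ∧ G.Adj b t ∧ G.Adj c t).card
    ≤ S.card + (S.filter fun t => G.Adj a t ∧ G.Adj b t).card
      + (S.filter fun t => G.Adj a t ∧ G.Adj c t).card
      + (S.filter fun t => G.Adj a t ∧ G.Adj d t).card
      + (S.filter fun t => G.Adj b t ∧ G.Adj c t).card
      + (S.filter fun t => G.Adj b t ∧ G.Adj d t).card
      + (S.filter fun t => G.Adj c t ∧ G.Adj d t).card := by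
  have nba := mt G.adj_symm nab
  have nca := mt G.adj_symm nac
  have nda := mt G.adj_symm nad
  have ncb := mt G.adj_symm nbc
  have ndb := mt G.adj_symm nbd
  have ndc := mt G.adj_symm ncd
  have h4 : (S.filter fun t => t ∈ ({a, b, c, d} : Finset V)).card = 4 := by
    have hQ : (S.filter fun t => t ∈ ({a, b, c, d} : Finset V)) = {a, b, c, d} := by
      ext t
      simp only [mem_filter, mem_insert, mem_singleton]
      constructor
      · exact fun ht => ht.2
      · rintro (rfl | rfl | rfl | rfl) <;> simp [*]
    rw [hQ]
    simp [*]
  rw [← h4, card_eq_sum_ones S]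
  simp only [card_filter, ← sum_add_distrib]
  refine sum_le_sum fun t _ => ?_
  by_cases ht : t ∈ ({a, b, c, d} : Finset V)
  · simp only [mem_insert, mem_singleton] at ht
    rcases ht with rfl | rfl | rfl | rfl <;> simp [*]
  · by_cases h1 : G.Adj a t <;> by_cases h2 : G.Adj b t <;> by_cases h3 : G.Adj c t <;>
      by_cases h4 : G.Adj d t <;> simp [*]

lemma card_filter_adj_not_adj_two (S : Finset V) (a b c : V) :
    (S.filter fun t => G.Adj c t ∧ ¬ G.Adj a t ∧ ¬ G.Adj b t).card
      + (S.filter fun t => G.Adj a t ∧ G.Adj c t).card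
      + (S.filter fun t => G.Adj b t ∧ G.Adj c t).card
    = (S.filter fun t => G.Adj c t).card
      + (S.filter fun t => G.Adj a t ∧ G.Adj b t ∧ G.Adj c t).card := by
  simp only [card_filter, ← sum_add_distrib]
  refine sum_congr rfl fun t _ => ?_
  by_cases h1 : G.Adj a t <;> by_cases h2 : G.Adj b t <;> by_cases h3 : G.Adj c t <;> simp [*]

lemma card_filter_not_adj_two [DecidableEq V] (S : Finset V) {a b : V}
    (ha : a ∈ S) (hb : b ∈ S)
    (hab : a ≠ b) (nab : ¬ G.Adj a b) :
    (S.filter fun t => t ≠ a ∧ t ≠ b ∧ ¬ G.Adj a t ∧ ¬ G.Adj b t).card + 2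
      + (S.filter fun t => G.Adj a t).card + (S.filter fun t => G.Adj b t).card
    = S.card + (S.filter fun t => G.Adj a t ∧ G.Adj b t).card := by
  have nba := mt G.adj_symm nab
  have h2 : (S.filter fun t => t ∈ ({a, b} : Finset V)).card = 2 := by
    have hQ : (S.filter fun t => t ∈ ({a, b} : Finset V)) = {a, b} := by
      ext t
      simp only [mem_filter, mem_insert, mem_singleton]
      constructor
      · exact fun ht => ht.2
      · rintro (rfl | rfl) <;> simp [*]
    rw [hQ, card_pair hab]
  rw [← h2, card_eq_sum_ones S]
  simp only [card_filter, ← sum_add_distrib]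
  refine sum_congr rfl fun t _ => ?_
  by_cases ht : t ∈ ({a, b} : Finset V)
  · simp only [mem_insert, mem_singleton] at ht
    rcases ht with rfl | rfl <;> simp [*]
  · simp only [mem_insert, mem_singleton, not_or] at ht
    by_cases h1 : G.Adj a t <;> by_cases h2 : G.Adj b t <;> simp [*]

end SimpleGraph

/-- Let `G` be a strongly regular graph with parameters `(1911, 270, 105, 27)` with an induced
quadrangle `x ~ u ~ y ~ v ~ x`, let `W = {w : w ~ x, w ∉ {u,v}, w ≁ u, w ≁ v}`, and for
`w ∈ W` let `k_w` be the number of neighbours of `w` inside `W`. Then `k_w ∈ {53, 54, |W|-1}`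
for all `w ∈ W`; moreover, if `|W| = 82` then `k_w ∈ {53, |W|-1}` for all `w ∈ W` and any two
distinct non-adjacent `z, z' ∈ W` satisfy `|N(x) ∩ N(z) ∩ N(z')| = 26`. -/
theorem srg_1911_W_valencies {V : Type*} [Fintype V] [DecidableEq V]
    (G : SimpleGraph V) [DecidableRel G.Adj] (h : G.IsSRGWith 1911 270 105 27)
    (x u y v : V)
    (hd : x ≠ u ∧ x ≠ y ∧ x ≠ v ∧ u ≠ y ∧ u ≠ v ∧ y ≠ v)
    (hxu : G.Adj x u) (huy : G.Adj u y) (hyv : G.Adj y v) (hvx : G.Adj v x)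
    (hxy : ¬ G.Adj x y) (huv : ¬ G.Adj u v)
    (W : Finset V)
    (hW : W = Finset.univ.filter fun w =>
      G.Adj x w ∧ w ≠ u ∧ w ≠ v ∧ ¬ G.Adj u w ∧ ¬ G.Adj v w) :
    (∀ w ∈ W, (W.filter fun z => G.Adj w z).card = 53 ∨
      (W.filter fun z => G.Adj w z).card = 54 ∨
      (W.filter fun z => G.Adj w z).card = W.card - 1) ∧
    (W.card = 82 →
      (∀ w ∈ W, (W.filter fun z => G.Adj w z).card = 53 ∨
        (W.filter fun z => G.Adj w z).card = W.card - 1) ∧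
      ∀ z ∈ W, ∀ z' ∈ W, z ≠ z' → ¬ G.Adj z z' →
        (G.neighborFinset x ∩ G.neighborFinset z ∩ G.neighborFinset z').card = 26) := by
  subst hW
  set S := G.neighborFinset x with hS
  have hu : u ∈ S := by simpa [hS] using hxu
  have hv : v ∈ S := by simpa [hS] using hvx.symm
  have hmem : ∀ {w}, w ∈ (Finset.univ.filter fun w =>
      G.Adj x w ∧ w ≠ u ∧ w ≠ v ∧ ¬ G.Adj u w ∧ ¬ G.Adj v w) →
      G.Adj x w ∧ w ≠ u ∧ w ≠ v ∧ ¬ G.Adj u w ∧ ¬ G.Adj v w := by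
    intro w hw
    simpa using hw
  have hWS : (Finset.univ.filter fun w =>
      G.Adj x w ∧ w ≠ u ∧ w ≠ v ∧ ¬ G.Adj u w ∧ ¬ G.Adj v w) =
      S.filter fun w => w ≠ u ∧ w ≠ v ∧ ¬ G.Adj u w ∧ ¬ G.Adj v w := by
    ext w
    simp [hS]
  have hScard : S.card = 270 := h.regular x
  have huv25 := h.card_common_add_card_le x hd.2.2.2.2.1 huv {x, y} (by
    simp only [Finset.mem_insert, Finset.mem_singleton]
    rintro t (rfl | rfl)
    · exact ⟨hxu.symm, hvx, G.irrefl⟩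
    · exact ⟨huy, hyv.symm, hxy⟩)
  rw [Finset.card_pair hd.2.1, ← hS] at huv25
  have hcommon : ∀ {a b}, G.Adj x a → G.Adj x b → a ≠ b → ¬ G.Adj a b →
      (S.filter fun t => G.Adj a t ∧ G.Adj b t).card + 1 ≤ 27 := by
    intro a b ha hb hab hnab
    refine h.card_common_add_card_le x hab hnab {x} ?_
    simp [ha.symm, hb.symm]
  have hWcard := SimpleGraph.card_filter_not_adj_two (G := G) S hu hv hd.2.2.2.2.1 huv
  rw [← hWS, h.card_filter_adj hxu, h.card_filter_adj hvx.symm] at hWcard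
  set W := Finset.univ.filter fun w =>
      G.Adj x w ∧ w ≠ u ∧ w ≠ v ∧ ¬ G.Adj u w ∧ ¬ G.Adj v w with hW
  have hkw : ∀ w ∈ W, (W.filter fun z => G.Adj w z).card
      + (S.filter fun t => G.Adj u t ∧ G.Adj w t).card
      + (S.filter fun t => G.Adj v t ∧ G.Adj w t).card
      = 105 + (S.filter fun t => G.Adj u t ∧ G.Adj v t ∧ G.Adj w t).card := by
    intro w hw
    obtain ⟨hxw, -, -, huw, hvw⟩ := hmem hw
    have hk := SimpleGraph.card_filter_adj_not_adj_two (G := G) S u v w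
    rw [h.card_filter_adj hxw] at hk
    rw [← hk]
    congr 3
    ext t
    simp only [hWS, Finset.mem_filter]
    constructor
    · tauto
    · rintro ⟨ht, hwt, hut, hvt⟩
      refine ⟨⟨ht, ?_, ?_, hut, hvt⟩, hwt⟩
      · rintro rfl
        exact huw hwt.symm
      · rintro rfl
        exact hvw hwt.symm
  have hfour : ∀ w ∈ W, ∀ z ∈ W, w ≠ z → ¬ G.Adj w z →
      154 + (S.filter fun t => G.Adj u t ∧ G.Adj v t ∧ G.Adj w t).card ≤
      (S.filter fun t => G.Adj u t ∧ G.Adj v t).card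
      + (S.filter fun t => G.Adj u t ∧ G.Adj w t).card
      + (S.filter fun t => G.Adj v t ∧ G.Adj w t).card
      + (S.filter fun t => G.Adj w t ∧ G.Adj z t).card + 52 := by
    intro w hw z hz hwz hnwz
    obtain ⟨hxw, hwu, hwv, huw, hvw⟩ := hmem hw
    obtain ⟨hxz, hzu, hzv, huz, hvz⟩ := hmem hz
    have key := SimpleGraph.card_coclique_four_le (G := G) S hu hv
      (by simpa [hS] using hxw) (by simpa [hS] using hxz) hd.2.2.2.2.1 hwu.symm hzu.symm
      hwv.symm hzv.symm hwz huv huw huz hvw hvz hnwz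
    rw [h.card_filter_adj hxu, h.card_filter_adj hvx.symm, h.card_filter_adj hxw,
      h.card_filter_adj hxz] at key
    have h1 := hcommon hxu hxz hzu.symm huz
    have h2 := hcommon hvx.symm hxz hzv.symm hvz
    omega
  have hval : ∀ w ∈ W, (∀ z ∈ W, w ≠ z → G.Adj w z) →
      (W.filter fun z => G.Adj w z).card = W.card - 1 := by
    intro w hw hall
    rw [← Finset.card_erase_of_mem hw]
    congr 1
    ext z
    simp only [Finset.mem_filter, Finset.mem_erase]
    exact ⟨fun hz => ⟨hz.2.ne', hz.1⟩, fun hz => ⟨hz.2, hall z hz.2 hz.1.symm⟩⟩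
  refine ⟨fun w hw => ?_, fun h82 => ⟨fun w hw => ?_, fun z hz z' hz' hzz hnzz => ?_⟩⟩
  · by_cases hall : ∀ z ∈ W, w ≠ z → G.Adj w z
    · exact Or.inr (Or.inr (hval w hw hall))
    · push Not at hall
      obtain ⟨z, hz, hwz, hnwz⟩ := hall
      obtain ⟨hxw, hwu, hwv, huw, hvw⟩ := hmem hw
      have h1 := hcommon hxu hxw hwu.symm huw
      have h2 := hcommon hvx.symm hxw hwv.symm hvw
      have h3 := hcommon hxw (hmem hz).1 hwz hnwz
      have h4 := hfour w hw z hz hwz hnwz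
      have h5 := hkw w hw
      omega
  · by_cases hall : ∀ z ∈ W, w ≠ z → G.Adj w z
    · exact Or.inr (hval w hw hall)
    · push Not at hall
      obtain ⟨z, hz, hwz, hnwz⟩ := hall
      obtain ⟨hxw, hwu, hwv, huw, hvw⟩ := hmem hw
      have h1 := hcommon hxu hxw hwu.symm huw
      have h2 := hcommon hvx.symm hxw hwv.symm hvw
      have h3 := hcommon hxw (hmem hz).1 hwz hnwz
      have h4 := hfour w hw z hz hwz hnwz
      have h5 := hkw w hw
      omega
  · obtain ⟨hxw, hwu, hwv, huw, hvw⟩ := hmem hz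
    have h1 := hcommon hxu hxw hwu.symm huw
    have h2 := hcommon hvx.symm hxw hwv.symm hvw
    have h3 := hcommon hxw (hmem hz').1 hzz hnzz
    have h4 := hfour z hz z' hz' hzz hnzz
    have h5 : S ∩ G.neighborFinset z ∩ G.neighborFinset z' =
        S.filter fun t => G.Adj z t ∧ G.Adj z' t := by
      ext t
      simp [hS]
    rw [h5]
    omega
end
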